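/- Let X be a σ-compact, locally compact metrizable topological space and F a nonempty closed subset of X such that the subspace X \ F is ultranormal. Then there exists a map Ξ : Met(F) → Met(X) satisfying properties (1)–(4) (extension, sup-distance isometry, monotonicity, and compatibility with pointwise maxima) and, in addition, Ξ maps every proper metric in Met(F) to a proper metric in Met(X). -/

import Mathlib

/-- A topological space is *ultranormal* if every pair of disjoint closed sets can be
separated by a clopen set. -/
def Ultranormal (X : Type*) [TopologicalSpace X] : Prop :=
  ∀ A B : Set X, IsClosed A → IsClosed B → Disjoint A B →
    ∃ C : Set X, IsClopen C ∧ A ⊆ C ∧ Disjoint C B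

/-- `d` belongs to `Met(Y)`: it is a metric on `Y` (as a bare function) whose metric
topology coincides with the given topology of `Y`. -/
def IsCompatMetric (Y : Type*) [TopologicalSpace Y] (d : Y → Y → ℝ) : Prop :=
  (∀ x y, 0 ≤ d x y) ∧ (∀ x y, d x y = d y x) ∧
  (∀ x y z, d x z ≤ d x y + d y z) ∧ (∀ x y, d x y = 0 ↔ x = y) ∧
  (∀ x : Y, ∀ s : Set Y, s ∈ nhds x ↔ ∃ ε > 0, {y : Y | d x y < ε} ⊆ s)

/-- A compatible metric (as a bare function) is proper if all its closed balls are
compact. -/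
def IsProperMetricFun {Y : Type*} [TopologicalSpace Y] (d : Y → Y → ℝ) : Prop :=
  ∀ x : Y, ∀ R : ℝ, IsCompact {y : Y | d x y ≤ R}

open Set Topology Metric

/-- In a Lindelöf space, a family of clopen neighbourhoods admits a locally constant choice of
a member containing each point. -/
lemma exists_isLocallyConstant_mem_of_isClopen {T : Type*} [TopologicalSpace T] [LindelofSpace T]
    (C : T → Set T) (hC : ∀ x, IsClopen (C x)) (hmem : ∀ x, x ∈ C x) :
    ∃ φ : T → T, IsLocallyConstant φ ∧ ∀ y, y ∈ C (φ y) := by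
  classical
  rcases isEmpty_or_nonempty T with hT | hT
  · exact ⟨id, IsLocallyConstant.of_constant _ fun x => (hT.false x).elim,
      fun y => (hT.false y).elim⟩
  obtain ⟨s, hs, hcov⟩ :=
    LindelofSpace.elim_nhds_subcover C fun x => (hC x).isOpen.mem_nhds (hmem x)
  have hsne : s.Nonempty := by
    obtain ⟨t⟩ := hT
    have ht : t ∈ ⋃ x ∈ s, C x := by rw [hcov]; trivial
    simp only [mem_iUnion] at ht
    obtain ⟨x, hx, -⟩ := ht
    exact ⟨x, hx⟩
  obtain ⟨g, rfl⟩ := hs.exists_eq_range hsne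
  have hex : ∀ y, ∃ n, y ∈ C (g n) := by
    intro y
    have hy : y ∈ ⋃ x ∈ range g, C x := by rw [hcov]; trivial
    simpa using hy
  have hfind : IsLocallyConstant fun y => Nat.find (hex y) := by
    rw [IsLocallyConstant.iff_eventually_eq]
    intro y
    have hin : ∀ᶠ z in 𝓝 y, z ∈ C (g (Nat.find (hex y))) :=
      (hC _).isOpen.mem_nhds (Nat.find_spec (hex y))
    have hout : ∀ᶠ z in 𝓝 y, ∀ m ∈ Finset.range (Nat.find (hex y)), z ∉ C (g m) := by
      rw [Filter.eventually_all_finset]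
      intro m hm
      exact (hC _).compl.isOpen.mem_nhds (Nat.find_min (hex y) (Finset.mem_range.1 hm))
    filter_upwards [hin, hout] with z hz hz'
    rw [Nat.find_eq_iff]
    exact ⟨hz, fun m hm => hz' m (Finset.mem_range.2 hm)⟩
  exact ⟨fun y => g (Nat.find (hex y)), hfind.comp g, fun y => Nat.find_spec (hex y)⟩

/-- A closed set with ultranormal complement is a retract, by a retraction moving every point
by at most twice its distance to the set. -/
lemma exists_retraction_dist_le {X : Type*} [MetricSpace X] [SecondCountableTopology X]
    {F : Set X} (hFne : F.Nonempty) (hFcl : IsClosed F) (hun : Ultranormal ↥(Fᶜ)) :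
    ∃ r : X → ↥F, Continuous r ∧ (∀ a : ↥F, r a = a) ∧
      ∀ x : X, dist x (r x) ≤ 2 * infDist x F := by
  classical
  have hpos : ∀ x : ↥(Fᶜ), 0 < infDist (x : X) F := fun x =>
    (hFcl.notMem_iff_infDist_pos hFne).1 x.2
  have hclopen : ∀ x : ↥(Fᶜ), ∃ C : Set ↥(Fᶜ), IsClopen C ∧ x ∈ C ∧
      C ⊆ ball x (infDist (x : X) F / 4) := by
    intro x
    obtain ⟨C, hC, hxC, hdisj⟩ := hun {x} (ball x (infDist (x : X) F / 4))ᶜ isClosed_singleton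
      isOpen_ball.isClosed_compl
      (by simpa using hpos x)
    exact ⟨C, hC, by simpa using hxC, disjoint_compl_right_iff_subset.1 hdisj⟩
  choose C hC hmem hsub using hclopen
  obtain ⟨φ, hφ, hφmem⟩ := exists_isLocallyConstant_mem_of_isClopen C hC hmem
  have hnear : ∀ x : ↥(Fᶜ), ∃ a : ↥F, dist (x : X) a < 5 / 4 * infDist (x : X) F := by
    intro x
    have hx := hpos x
    obtain ⟨a, ha, hlt⟩ := (infDist_lt_iff hFne).1
      (show infDist (x : X) F < 5 / 4 * infDist (x : X) F by linarith)
    exact ⟨⟨a, ha⟩, hlt⟩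
  choose p hp using hnear
  let r : X → ↥F := fun x => if h : x ∈ F then ⟨x, h⟩ else p (φ ⟨x, h⟩)
  have hrF : ∀ a : ↥F, r a = a := fun a => by simp [r]
  have hdist : ∀ x : X, dist x (r x) ≤ 2 * infDist x F := by
    intro x
    by_cases h : x ∈ F
    · simp [r, h, infDist_nonneg]
    · have hrx : r x = p (φ ⟨x, h⟩) := by simp [r, h]
      rw [hrx]
      set z := φ ⟨x, h⟩ with hz
      have hxz : dist x z < infDist (z : X) F / 4 := hsub z (hφmem ⟨x, h⟩)
      have hza := hp z
      have htri := dist_triangle x z (p z)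
      have hinf : infDist (z : X) F ≤ infDist x F + dist (z : X) x := infDist_le_infDist_add_dist
      rw [dist_comm] at hinf
      linarith
  refine ⟨r, continuous_iff_continuousAt.2 fun x => ?_, hrF, hdist⟩
  by_cases h : x ∈ F
  · rw [ContinuousAt, tendsto_iff_dist_tendsto_zero]
    have hlim : Filter.Tendsto (fun y => 3 * dist y x) (𝓝 x) (𝓝 0) := by
      have : Continuous fun y => 3 * dist y x := by fun_prop
      simpa using this.tendsto x
    refine squeeze_zero (fun _ => dist_nonneg) (fun y => ?_) hlim
    have hrx : ((r x : ↥F) : X) = x := by simp [r, h]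
    rw [Subtype.dist_eq, hrx]
    have h1 := dist_triangle ((r y : ↥F) : X) y x
    have h2 := hdist y
    rw [dist_comm] at h2
    have h3 := infDist_le_dist_of_mem (x := y) h
    linarith
  · have hcont : Continuous fun y : ↥(Fᶜ) => r y := by
      have heq : (fun y : ↥(Fᶜ) => r y) = fun y => p (φ y) := by
        funext y
        have hy : (y : X) ∉ F := y.2
        simp [r, hy]
      rw [heq]
      exact (hφ.comp p).continuous
    exact (hFcl.isOpen_compl.isOpenEmbedding_subtypeVal.continuousAt_iff (x := ⟨x, h⟩)).1
      hcont.continuousAt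

/-- A σ-compact locally compact metrizable space carries a compatible proper metric. -/
lemma exists_properSpace_metricSpace (X : Type*) [t : TopologicalSpace X]
    [TopologicalSpace.MetrizableSpace X] [SigmaCompactSpace X] [LocallyCompactSpace X] :
    ∃ m : MetricSpace X, m.toPseudoMetricSpace.toUniformSpace.toTopologicalSpace = t ∧
      @ProperSpace X m.toPseudoMetricSpace := by
  let m₀ : MetricSpace X := TopologicalSpace.metrizableSpaceMetric X
  let K : CompactExhaustion X := default
  obtain ⟨f, hf⟩ := exists_continuous_forall_mem_convex_of_local_const
    (t := fun x : X => Ici (K.find x : ℝ)) (fun _ => convex_Ici _) fun x => by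
      refine ⟨((K.find x + 1 : ℕ) : ℝ), ?_⟩
      filter_upwards [mem_interior_iff_mem_nhds.1
        (K.subset_interior_succ (K.find x) (K.mem_find x))] with y hy
      exact Nat.cast_le (α := ℝ).2 (K.mem_iff_find_le.1 hy)
  have hcompact : ∀ R : ℝ, IsCompact {y | f y ≤ R} := by
    intro R
    refine (K.isCompact ⌈R⌉₊).of_isClosed_subset (isClosed_le f.continuous continuous_const) ?_
    intro y hy
    rw [K.mem_iff_find_le]
    exact_mod_cast (hf y).trans (le_trans hy (Nat.le_ceil R))
  have hemb : IsEmbedding fun x : X => (x, f x) :=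
    .of_comp (by fun_prop) continuous_fst .id
  have habs : ∀ x y R, dist (y, f y) (x, f x) ≤ R → |f y - f x| ≤ R :=
    fun _ _ _ h => (le_max_right _ _).trans h
  refine ⟨hemb.comapMetricSpace, rfl, ?_⟩
  let := hemb.comapMetricSpace
  refine ⟨fun x R => (hcompact (f x + R)).of_isClosed_subset isClosed_closedBall ?_⟩
  intro y hy
  have := (abs_le.1 (habs x y R hy)).2
  simp only [mem_ofPred_eq]
  linarith

lemma IsCompatMetric.isClosed_setOf_le {Y : Type*} [TopologicalSpace Y] {d : Y → Y → ℝ}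
    (hd : IsCompatMetric Y d) (x : Y) (R : ℝ) : IsClosed {y | d x y ≤ R} := by
  obtain ⟨-, hsymm, htri, -, hnhds⟩ := hd
  rw [← isOpen_compl_iff, isOpen_iff_mem_nhds]
  intro y hy
  simp only [mem_compl_iff, mem_ofPred_eq, not_le] at hy
  refine (hnhds y _).2 ⟨d x y - R, by linarith, fun z hz => ?_⟩
  simp only [mem_compl_iff, mem_ofPred_eq, not_le] at hz ⊢
  have := htri x z y
  rw [hsymm z y] at this
  linarith

/-- The pseudometric on `X` obtained by collapsing `F` to a point. -/
noncomputable def collapseDist {X : Type*} [MetricSpace X] (F : Set X) (x y : X) : ℝ :=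
  min (dist x y) (infDist x F + infDist y F)

section collapseDist

variable {X : Type*} [MetricSpace X] {F : Set X}

lemma collapseDist_nonneg (x y : X) : 0 ≤ collapseDist F x y :=
  le_min dist_nonneg (add_nonneg infDist_nonneg infDist_nonneg)

lemma collapseDist_self (x : X) : collapseDist F x x = 0 :=
  le_antisymm ((min_le_left _ _).trans (dist_self x).le) (collapseDist_nonneg x x)

lemma collapseDist_comm (x y : X) : collapseDist F x y = collapseDist F y x := by
  rw [collapseDist, collapseDist, dist_comm, add_comm]

lemma collapseDist_triangle (x y z : X) :
    collapseDist F x z ≤ collapseDist F x y + collapseDist F y z := by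
  have h1 := dist_triangle x y z
  have h2 : infDist x F ≤ infDist y F + dist x y := infDist_le_infDist_add_dist
  have h3 : infDist z F ≤ infDist y F + dist z y := infDist_le_infDist_add_dist
  rw [dist_comm z y] at h3
  have h4 : 0 ≤ infDist y F := infDist_nonneg
  have h5 := min_le_left (dist x z) (infDist x F + infDist z F)
  have h6 := min_le_right (dist x z) (infDist x F + infDist z F)
  unfold collapseDist
  rcases min_cases (dist x y) (infDist x F + infDist y F) with h | h <;>
  rcases min_cases (dist y z) (infDist y F + infDist z F) with h' | h' <;>
  rw [h.1, h'.1] <;> linarith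

lemma collapseDist_of_mem {x : X} (hx : x ∈ F) (y : X) : collapseDist F x y = infDist y F := by
  rw [collapseDist, infDist_zero_of_mem hx, zero_add, min_eq_right]
  rw [dist_comm]
  exact infDist_le_dist_of_mem hx

lemma dist_lt_of_collapseDist_lt {x y : X} {δ : ℝ}
    (h : collapseDist F x y < δ) (hδ : δ ≤ infDist x F) : dist x y < δ := by
  rcases min_lt_iff.1 h with h | h
  · exact h
  · linarith [infDist_nonneg (x := y) (s := F)]

end collapseDist

/-- The extension of a metric on `F` along a retraction `r : X → F`. -/
noncomputable def extendMetric {X : Type*} [MetricSpace X] {F : Set X} (r : X → ↥F)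
    (d : ↥F → ↥F → ℝ) (x y : X) : ℝ :=
  max (d (r x) (r y)) (collapseDist F x y)

section extendMetric

variable {X : Type*} [MetricSpace X] {F : Set X} {r : X → ↥F}

lemma extendMetric_apply_coe {d : ↥F → ↥F → ℝ} (hd : IsCompatMetric ↥F d)
    (hrF : ∀ a : ↥F, r a = a) (a b : ↥F) : extendMetric r d a b = d a b := by
  rw [extendMetric, hrF, hrF, collapseDist_of_mem a.2, infDist_zero_of_mem b.2]
  exact max_eq_left (hd.1 a b)

lemma IsCompatMetric.extendMetric {d : ↥F → ↥F → ℝ} (hd : IsCompatMetric ↥F d)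
    (hFne : F.Nonempty) (hFcl : IsClosed F) (hr : Continuous r) (hrF : ∀ a : ↥F, r a = a)
    (hdist : ∀ x : X, dist x (r x) ≤ 2 * infDist x F) : IsCompatMetric X (extendMetric r d) := by
  have hcoe := extendMetric_apply_coe hd hrF
  obtain ⟨-, hsymm, htri, heq, hnhds⟩ := hd
  have hball : ∀ x : X, ∀ s ∈ 𝓝 x, ∃ ε > 0, {y : X | _root_.extendMetric r d x y < ε} ⊆ s := by
    intro x s hs
    obtain ⟨δ, hδ, hsub⟩ := Metric.mem_nhds_iff.1 hs
    by_cases hx : x ∈ F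
    · obtain ⟨ε, hε, hεsub⟩ := (hnhds ⟨x, hx⟩ (ball ⟨x, hx⟩ (δ / 2))).1
        (ball_mem_nhds _ (half_pos hδ))
      refine ⟨min ε (δ / 4), by positivity, fun y hy => hsub ?_⟩
      obtain ⟨h1, h2⟩ := max_lt_iff.1 (show max (d (r x) (r y)) (collapseDist F x y) < _ from hy)
      rw [hrF ⟨x, hx⟩] at h1
      rw [collapseDist_of_mem hx] at h2
      have h3 : dist ((r y : ↥F) : X) x < δ / 2 := hεsub (h1.trans_le (min_le_left _ _))
      have h4 := h2.trans_le (min_le_right _ _)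
      have h5 := hdist y
      have h6 := dist_triangle y (r y) x
      rw [mem_ball]
      linarith
    · have hpos := (hFcl.notMem_iff_infDist_pos hFne).1 hx
      refine ⟨min δ (infDist x F), by positivity, fun y hy => hsub ?_⟩
      have h2 := (max_lt_iff.1 (show max (d (r x) (r y)) (collapseDist F x y) < _ from hy)).2
      rw [mem_ball, dist_comm]
      exact (dist_lt_of_collapseDist_lt h2 (min_le_right _ _)).trans_le (min_le_left _ _)
  have hzero : ∀ x, _root_.extendMetric r d x x = 0 := fun x => by
    rw [_root_.extendMetric, (heq _ _).2 rfl, collapseDist_self, max_self]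
  refine ⟨fun x y => (collapseDist_nonneg x y).trans (le_max_right _ _),
    fun x y => by rw [_root_.extendMetric, _root_.extendMetric, hsymm, collapseDist_comm],
    fun x y z => ?_, fun x y => ⟨fun h => ?_, fun h => h ▸ hzero x⟩,
    fun x s => ⟨hball x s, ?_⟩⟩
  · exact max_le
      ((htri _ (r y) _).trans (add_le_add (le_max_left _ _) (le_max_left _ _)))
      ((collapseDist_triangle x y z).trans (add_le_add (le_max_right _ _) (le_max_right _ _)))
  · by_contra hne
    obtain ⟨ε, hε, hsub⟩ := hball x {y}ᶜ (isOpen_compl_singleton.mem_nhds hne)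
    exact hsub (show _root_.extendMetric r d x y < ε by rwa [h]) rfl
  · rintro ⟨ε, hε, hsub⟩
    refine Filter.mem_of_superset ?_ hsub
    have h1 : ∀ᶠ y in 𝓝 x, d (r x) (r y) < ε :=
      hr.continuousAt ((hnhds (r x) {a | d (r x) a < ε}).2 ⟨ε, hε, subset_rfl⟩)
    filter_upwards [h1, ball_mem_nhds x hε] with y hy hy'
    rw [mem_ball, dist_comm] at hy'
    exact max_lt hy ((min_le_left _ _).trans_lt hy')

lemma abs_extendMetric_sub_le (d e : ↥F → ↥F → ℝ) (x y : X) :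
    |extendMetric r d x y - extendMetric r e x y| ≤ |d (r x) (r y) - e (r x) (r y)| :=
  abs_max_sub_max_le_abs _ _ _

lemma IsProperMetricFun.extendMetric [ProperSpace X] {d : ↥F → ↥F → ℝ}
    (hd : IsProperMetricFun d) (hcompat : IsCompatMetric X (extendMetric r d))
    (hdist : ∀ x : X, dist x (r x) ≤ 2 * infDist x F) : IsProperMetricFun (extendMetric r d) := by
  intro x R
  obtain ⟨M, hM⟩ := ((hd (r x) R).image continuous_subtype_val).isBounded.subset_closedBall x
  refine (isCompact_closedBall x (max R (M + 2 * (R + infDist x F)))).of_isClosed_subset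
    (hcompat.isClosed_setOf_le x R) fun y hy => ?_
  obtain ⟨h1, h2⟩ := max_le_iff.1 (show max (d (r x) (r y)) (collapseDist F x y) ≤ _ from hy)
  rw [mem_closedBall, le_max_iff]
  rcases min_le_iff.1 h2 with h | h
  · left
    rwa [dist_comm]
  · right
    have h3 : dist ((r y : ↥F) : X) x ≤ M := hM ⟨r y, h1, rfl⟩
    have h4 := hdist y
    have h5 := dist_triangle y (r y) x
    have h6 : 0 ≤ infDist x F := infDist_nonneg
    linarith

end extendMetric

theorem exists_metric_extensor_proper {X : Type*} [TopologicalSpace X]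
    [TopologicalSpace.MetrizableSpace X] [SigmaCompactSpace X] [LocallyCompactSpace X]
    (F : Set X) (hFne : F.Nonempty) (hFcl : IsClosed F)
    (hun : Ultranormal ↥(Fᶜ)) :
    ∃ Ξ : (↥F → ↥F → ℝ) → (X → X → ℝ),
      (∀ d, IsCompatMetric ↥F d → IsCompatMetric X (Ξ d)) ∧
      -- (1) extension
      (∀ d, IsCompatMetric ↥F d → ∀ a b : ↥F, Ξ d (a : X) (b : X) = d a b) ∧
      -- (2) sup-distance isometry (in [0, ∞])
      (∀ d e, IsCompatMetric ↥F d → IsCompatMetric ↥F e →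
        (⨆ x : X, ⨆ y : X, ENNReal.ofReal |Ξ d x y - Ξ e x y|) =
          (⨆ a : ↥F, ⨆ b : ↥F, ENNReal.ofReal |d a b - e a b|)) ∧
      -- (3) monotonicity
      (∀ d e, IsCompatMetric ↥F d → IsCompatMetric ↥F e →
        (∀ a b : ↥F, d a b ≤ e a b) → ∀ x y : X, Ξ d x y ≤ Ξ e x y) ∧
      -- (4) compatibility with pointwise maxima
      (∀ d e, IsCompatMetric ↥F d → IsCompatMetric ↥F e →
        ∀ x y : X, Ξ (fun a b => max (d a b) (e a b)) x y = max (Ξ d x y) (Ξ e x y)) ∧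
      -- preservation of properness
      (∀ d, IsCompatMetric ↥F d → IsProperMetricFun d → IsProperMetricFun (Ξ d)) := by
  obtain ⟨m, rfl, hproper⟩ := exists_properSpace_metricSpace X
  obtain ⟨r, hr, hrF, hdist⟩ := exists_retraction_dist_le hFne hFcl hun
  have hcompat : ∀ d, IsCompatMetric ↥F d → IsCompatMetric X (extendMetric r d) :=
    fun d hd => hd.extendMetric hFne hFcl hr hrF hdist
  refine ⟨extendMetric r, hcompat, fun d hd => extendMetric_apply_coe hd hrF,
    fun d e hd he => le_antisymm ?_ ?_, fun d e _ _ hde x y => max_le_max (hde _ _) le_rfl,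
    fun d e _ _ x y => sup_sup_distrib_right _ _ _,
    fun d hd hdp => hdp.extendMetric (hcompat d hd) hdist⟩
  · refine iSup₂_le fun x y => ?_
    exact (ENNReal.ofReal_le_ofReal (abs_extendMetric_sub_le d e x y)).trans
      (le_iSup₂ (f := fun a b : ↥F => ENNReal.ofReal |d a b - e a b|) (r x) (r y))
  · refine iSup₂_le fun a b => ?_
    rw [← extendMetric_apply_coe hd hrF, ← extendMetric_apply_coe he hrF]
    exact le_iSup₂ (f := fun x y : X =>
      ENNReal.ofReal |extendMetric r d x y - extendMetric r e x y|) (a : X) (b : X)
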